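/- arXiv:2110.13949 — 3 statements merged into one kernel-verified Lean document; each statement's English description precedes it below -/
import Mathlib

section
/- Let ε be an edge-weight function on a finite set V with n = |V| and d_ε(v) > 0 for all v ∈ V. Let R be a set of edges of G(ε), let V_R be the set of endpoints of edges in R, s = |V_R|, c the number of connected components of the graph (V_R, R), and b the number of those components that are bipartite. Let ε_del agree with ε except that ε_del(u,v) = ε_del(v,u) = 0 for every {u,v} ∈ R, and let S = {v ∈ V : d_{ε_del}(v) = 0} with k = |S|. Let λ_1 ≤ … ≤ λ_n denote the normalised Laplacian eigenvalues of ε, and μ_1 ≤ … ≤ μ_{n−k} the normalised Laplacian eigenvalues of ε_del restricted to V ∖ S (all degrees of this restriction are positive). Then for all 1 ≤ i ≤ n−k: λ_{i−s+c+k} ≤ μ_i whenever i−s+c+k ≥ 1, and μ_i ≤ λ_{i+s−b} whenever i+s−b ≤ n. -/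
open Matrix Polynomial
open scoped Classical

/-- The combinatorial Laplacian of an edge-weight function. -/
noncomputable def lapMat {V : Type} [Fintype V] [DecidableEq V] (ε : V → V → ℝ) :
    Matrix V V ℝ :=
  Matrix.diagonal (fun v => ∑ u, ε v u) - Matrix.of ε

/-- The weighted Laplacian `W(υ)⁻¹ · L(ε)`, whose eigenvalues coincide with those of
the symmetric matrix `W(υ)^{-1/2} L(ε) W(υ)^{-1/2}`. -/
noncomputable def wlap {V : Type} [Fintype V] [DecidableEq V]
    (ε : V → V → ℝ) (υ : V → ℝ) : Matrix V V ℝ :=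
  Matrix.diagonal (fun v => (υ v)⁻¹) * lapMat ε

/-- Families of real numbers with the same product of linear factors agree up to reindexing. -/
lemma exists_equiv_of_prod_X_sub_C_eq {ι κ : Type*} [Fintype ι] [Fintype κ]
    (f : ι → ℝ) (g : κ → ℝ) (h : ∏ i, (X - C (f i)) = ∏ j, (X - C (g j))) :
    ∃ σ : ι ≃ κ, ∀ i, g (σ i) = f i := by
  have hmap : Finset.univ.val.map f = Finset.univ.val.map g := by
    have := congrArg Polynomial.roots h
    rwa [Polynomial.roots_prod _ _ (by simp [Finset.prod_ne_zero_iff, X_sub_C_ne_zero]),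
      Polynomial.roots_prod _ _ (by simp [Finset.prod_ne_zero_iff, X_sub_C_ne_zero]),
      Multiset.bind_congr (fun i _ => roots_X_sub_C (f i)),
      Multiset.bind_congr (fun i _ => roots_X_sub_C (g i)),
      Multiset.bind_singleton, Multiset.bind_singleton] at this
  have hcard (a : ℝ) : Fintype.card {i // f i = a} = Fintype.card {j // g j = a} := by
    have := congrArg (Multiset.count a) hmap
    rw [Multiset.count_map, Multiset.count_map] at this
    rw [Fintype.card_subtype, Fintype.card_subtype, Finset.card_def, Finset.card_def,
      Finset.filter_val, Finset.filter_val]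
    simpa only [eq_comm] using this
  exact ⟨Equiv.ofFiberEquiv fun a => Fintype.equivOfCardEq (hcard a),
    fun i => Equiv.ofFiberEquiv_map _ i⟩

/-- Simultaneous diagonalisation of the mass form and of the Laplacian form. -/
lemma exists_linearEquiv_diagonalizing {ι : Type} [Fintype ι] [DecidableEq ι] {m : ℕ}
    (ε : ι → ι → ℝ) (hsym : ∀ u v, ε u v = ε v u) (d : ι → ℝ) (hd : ∀ v, 0 < d v)
    (lam : Fin m → ℝ) (h : (wlap ε d).charpoly = ∏ i, (X - C (lam i))) :
    ∃ Φ : (ι → ℝ) ≃ₗ[ℝ] (Fin m → ℝ), ∀ x,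
      ∑ v, d v * x v ^ 2 = ∑ i, Φ x i ^ 2 ∧
      x ⬝ᵥ (lapMat ε *ᵥ x) = ∑ i, lam i * Φ x i ^ 2 := by
  set r : ι → ℝ := fun v => Real.sqrt (d v)
  have hr (v) : r v ≠ 0 := (Real.sqrt_pos.2 (hd v)).ne'
  have hrr (v) : r v * r v = d v := Real.mul_self_sqrt (hd v).le
  set D : Matrix ι ι ℝ := diagonal r
  set D' : Matrix ι ι ℝ := diagonal fun v => (r v)⁻¹
  have hDD' : D * D' = 1 := by simp [D, D', diagonal_mul_diagonal, hr]
  have hD'D : D' * D = 1 := by simp [D, D', diagonal_mul_diagonal, hr]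
  have hA : (D' * lapMat ε * D').IsHermitian := by
    have hL : (lapMat ε)ᵀ = lapMat ε := by
      rw [lapMat, transpose_sub, diagonal_transpose]
      congr 1
      ext u v
      exact hsym v u
    rw [IsHermitian, conjTranspose_eq_transpose_of_trivial, transpose_mul, transpose_mul, hL,
      diagonal_transpose, mul_assoc]
  have hchar : (D' * lapMat ε * D').charpoly = (wlap ε d).charpoly := by
    rw [charpoly_mul_comm, ← mul_assoc, diagonal_mul_diagonal, wlap]
    simp_rw [← mul_inv, hrr]
  obtain ⟨σ, hσ⟩ := exists_equiv_of_prod_X_sub_C_eq lam hA.eigenvalues (by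
    rw [← h, ← hchar, hA.charpoly_eq]; rfl)
  set U : Matrix ι ι ℝ := hA.eigenvectorUnitary.val
  have hU : Uᵀ * U = 1 := by
    simpa [star_eq_conjTranspose] using Unitary.coe_star_mul_self hA.eigenvectorUnitary
  have hU' : U * Uᵀ = 1 := by
    simpa [star_eq_conjTranspose] using Unitary.coe_mul_star_self hA.eigenvectorUnitary
  have hspec : D' * lapMat ε * D' = U * diagonal hA.eigenvalues * Uᵀ := by
    have := hA.spectral_theorem
    rw [Unitary.conjStarAlgAut_apply] at this
    simpa [star_eq_conjTranspose] using this
  set P := Uᵀ * D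
  have hPt : Pᵀ = D * U := by simp [P, D, transpose_mul]
  have hPP : Pᵀ * P = diagonal d := by
    calc Pᵀ * P = D * (U * Uᵀ) * D := by rw [hPt]; simp only [P, mul_assoc]
      _ = diagonal d := by rw [hU', mul_one, diagonal_mul_diagonal]; simp_rw [hrr]
  have hPL : Pᵀ * diagonal hA.eigenvalues * P = lapMat ε := by
    calc Pᵀ * diagonal hA.eigenvalues * P = D * (U * diagonal hA.eigenvalues * Uᵀ) * D := by
          rw [hPt]; simp only [P, mul_assoc]
      _ = (D * D') * lapMat ε * (D' * D) := by rw [← hspec]; simp only [mul_assoc]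
      _ = lapMat ε := by rw [hDD', hD'D, one_mul, mul_one]
  have hQP : (D' * U) * P = 1 := by
    calc (D' * U) * P = D' * (U * Uᵀ) * D := by simp only [P, mul_assoc]
      _ = 1 := by rw [hU', mul_one, hD'D]
  refine ⟨(Matrix.toLinearEquiv' P (invertibleOfLeftInverse P _ hQP)).trans
    (LinearEquiv.funCongrLeft ℝ ℝ σ), fun x => ?_⟩
  have happ (i) : ((Matrix.toLinearEquiv' P (invertibleOfLeftInverse P _ hQP)).trans
    (LinearEquiv.funCongrLeft ℝ ℝ σ)) x i = (P *ᵥ x) (σ i) := rfl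
  have hform (e : ι → ℝ) : x ⬝ᵥ ((Pᵀ * diagonal e * P) *ᵥ x) = ∑ i, e i * (P *ᵥ x) i ^ 2 := by
    rw [← mulVec_mulVec, ← mulVec_mulVec, dotProduct_mulVec, vecMul_transpose, dotProduct]
    refine Finset.sum_congr rfl fun i _ => ?_
    rw [mulVec_diagonal]
    ring
  simp_rw [happ]
  constructor
  · rw [σ.sum_comp fun i => (P *ᵥ x) i ^ 2]
    have := hform 1
    rw [diagonal_one', mul_one, hPP] at this
    simp only [Pi.one_apply, one_mul] at this
    rw [← this, dotProduct]
    refine Finset.sum_congr rfl fun i _ => ?_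
    rw [mulVec_diagonal]
    ring
  · rw [← hPL, hform, ← σ.sum_comp]
    simp_rw [hσ]

/-- The Laplacian quadratic form, together with its signless counterpart. -/
lemma dotProduct_lapMat_mulVec {ι : Type} [Fintype ι] [DecidableEq ι] (ε : ι → ι → ℝ)
    (hsym : ∀ u v, ε u v = ε v u) (x : ι → ℝ) :
    x ⬝ᵥ (lapMat ε *ᵥ x) = (∑ u, ∑ v, ε u v * (x u - x v) ^ 2) / 2 ∧
    x ⬝ᵥ (lapMat ε *ᵥ x) =
      2 * ∑ v, (∑ u, ε v u) * x v ^ 2 - (∑ u, ∑ v, ε u v * (x u + x v) ^ 2) / 2 := by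
  have hL : x ⬝ᵥ (lapMat ε *ᵥ x) =
      ∑ v, (∑ u, ε v u) * x v ^ 2 - ∑ u, ∑ v, ε u v * (x u * x v) := by
    rw [lapMat, sub_mulVec, dotProduct_sub]
    congr 1
    · refine Finset.sum_congr rfl fun i _ => ?_
      rw [mulVec_diagonal]
      ring
    · refine Finset.sum_congr rfl fun i _ => ?_
      rw [mulVec, dotProduct, Finset.mul_sum]
      refine Finset.sum_congr rfl fun j _ => ?_
      rw [of_apply]
      ring
  have h1 : ∑ u, ∑ v, ε u v * x u ^ 2 = ∑ v, (∑ u, ε v u) * x v ^ 2 := by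
    simp_rw [Finset.sum_mul]
  have h2 : ∑ u, ∑ v, ε u v * x v ^ 2 = ∑ v, (∑ u, ε v u) * x v ^ 2 := by
    rw [Finset.sum_comm, ← h1]
    simp_rw [hsym]
  have h3 : ∑ u, ∑ v, ε u v * (x u - x v) ^ 2 = ∑ u, ∑ v, ε u v * x u ^ 2 +
      ∑ u, ∑ v, ε u v * x v ^ 2 - 2 * ∑ u, ∑ v, ε u v * (x u * x v) := by
    simp_rw [Finset.mul_sum, ← Finset.sum_add_distrib, ← Finset.sum_sub_distrib]
    refine Finset.sum_congr rfl fun i _ => Finset.sum_congr rfl fun j _ => ?_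
    ring
  have h4 : ∑ u, ∑ v, ε u v * (x u + x v) ^ 2 = ∑ u, ∑ v, ε u v * x u ^ 2 +
      ∑ u, ∑ v, ε u v * x v ^ 2 + 2 * ∑ u, ∑ v, ε u v * (x u * x v) := by
    simp_rw [Finset.mul_sum, ← Finset.sum_add_distrib]
    refine Finset.sum_congr rfl fun i _ => Finset.sum_congr rfl fun j _ => ?_
    ring
  constructor
  · linarith
  · linarith

/-- The normalised Laplacian eigenvalues lie in the interval from `0` to `2`. -/
lemma normalised_eigenvalue_mem_Icc {ι : Type} [Fintype ι] [DecidableEq ι] {m : ℕ}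
    (ε : ι → ι → ℝ) (hsym : ∀ u v, ε u v = ε v u) (hnonneg : ∀ u v, 0 ≤ ε u v)
    (lam : Fin m → ℝ) (Φ : (ι → ℝ) ≃ₗ[ℝ] (Fin m → ℝ))
    (hΦ : ∀ x, ∑ v, (∑ u, ε v u) * x v ^ 2 = ∑ i, Φ x i ^ 2 ∧
      x ⬝ᵥ (lapMat ε *ᵥ x) = ∑ i, lam i * Φ x i ^ 2) (i : Fin m) :
    lam i ∈ Set.Icc 0 2 := by
  set x := Φ.symm (Pi.single i 1)
  obtain ⟨h1, h2⟩ := hΦ x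
  obtain ⟨h3, h4⟩ := dotProduct_lapMat_mulVec ε hsym x
  have h5 : ∑ j, Φ x j ^ 2 = 1 := by
    simp [x, Pi.single_apply]
  have h6 : ∑ j, lam j * Φ x j ^ 2 = lam i := by
    simp [x, Pi.single_apply]
  have h7 : 0 ≤ ∑ u, ∑ v, ε u v * (x u - x v) ^ 2 :=
    Finset.sum_nonneg fun u _ => Finset.sum_nonneg fun v _ =>
      mul_nonneg (hnonneg u v) (sq_nonneg _)
  have h8 : 0 ≤ ∑ u, ∑ v, ε u v * (x u + x v) ^ 2 :=
    Finset.sum_nonneg fun u _ => Finset.sum_nonneg fun v _ =>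
      mul_nonneg (hnonneg u v) (sq_nonneg _)
  constructor <;> linarith

/-- Vectors on `A` that are, on each good fibre of `p`, a multiple of the nowhere vanishing `τ`
and zero on the other fibres, are cut out by `|A|` minus the number of good fibres linear
equations. -/
lemma exists_functionals_of_fibres {ι W : Type*} [DecidableEq ι] [DecidableEq W]
    (A : Finset ι) (p : ι → W) (P : W → Prop) [DecidablePred P] (τ : ι → ℝ)
    (hτ : ∀ v, P (p v) → τ v ≠ 0) :
    ∃ (K : Finset ι) (l : ι → (ι → ℝ) →ₗ[ℝ] ℝ),
      K.card + ((A.image p).filter P).card = A.card ∧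
      ∀ x, (∀ v ∈ K, l v x = 0) →
        ∃ z : W → ℝ, ∀ v ∈ A, x v = if P (p v) then τ v * z (p v) else 0 := by
  rcases isEmpty_or_nonempty ι with hι | hι
  · exact ⟨∅, 0, by simp [A.eq_empty_of_isEmpty], fun x _ => ⟨0, fun v => isEmptyElim v⟩⟩
  have hex (w : W) (hw : w ∈ (A.image p).filter P) : ∃ r, r ∈ A ∧ p r = w :=
    Finset.mem_image.1 (Finset.mem_filter.1 hw).1
  choose! rep hrep using hex
  set T := ((A.image p).filter P).image rep
  have hTA : T ⊆ A := by
    intro v hv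
    obtain ⟨w, hw, rfl⟩ := Finset.mem_image.1 hv
    exact (hrep w hw).1
  have hTcard : T.card = ((A.image p).filter P).card :=
    Finset.card_image_of_injOn fun w hw w' hw' h => by
      rw [← (hrep w hw).2, ← (hrep w' hw').2, h]
  refine ⟨A \ T, fun v => if P (p v) then
    LinearMap.proj v - (τ v / τ (rep (p v))) • LinearMap.proj (rep (p v)) else LinearMap.proj v,
    by rw [← hTcard, Finset.card_sdiff_add_card_eq_card hTA], fun x hx => ?_⟩
  refine ⟨fun w => x (rep w) / τ (rep w), fun v hv => ?_⟩
  by_cases hP : P (p v)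
  · have hmem : p v ∈ (A.image p).filter P :=
      Finset.mem_filter.2 ⟨Finset.mem_image_of_mem p hv, hP⟩
    have hr := hrep _ hmem
    have hτr : τ (rep (p v)) ≠ 0 := hτ _ (by rwa [hr.2])
    rw [if_pos hP]
    by_cases hvT : v ∈ T
    · obtain ⟨w, hw, rfl⟩ := Finset.mem_image.1 hvT
      rw [(hrep w hw).2] at hτr ⊢
      field_simp
    · have := hx v (Finset.mem_sdiff.2 ⟨hv, hvT⟩)
      simp only [if_pos hP, LinearMap.sub_apply, LinearMap.proj_apply, LinearMap.smul_apply,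
        smul_eq_mul, sub_eq_zero] at this
      rw [this]
      ring
  · have hvT : v ∉ T := fun hvT => by
      obtain ⟨w, hw, rfl⟩ := Finset.mem_image.1 hvT
      rw [(hrep w hw).2] at hP
      exact hP (Finset.mem_filter.1 hw).2
    have := hx v (Finset.mem_sdiff.2 ⟨hv, hvT⟩)
    simpa only [if_neg hP, LinearMap.proj_apply] using this

/-- Fewer homogeneous linear equations than unknowns have a nonzero common solution. -/
lemma exists_ne_zero_of_card_lt {ι κ : Type*} [Fintype ι] [Fintype κ]
    (l : κ → (ι → ℝ) →ₗ[ℝ] ℝ) (h : Fintype.card κ < Fintype.card ι) :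
    ∃ x ≠ 0, ∀ k, l k x = 0 := by
  have := LinearMap.ker_ne_bot_of_finrank_lt (f := LinearMap.pi l) (by simpa using h)
  obtain ⟨x, hx, hx0⟩ := (Submodule.ne_bot_iff _).1 this
  exact ⟨x, hx0, fun k => congrFun (LinearMap.mem_ker.1 hx) k⟩

/-- A nonzero vector killed by prescribed coordinates of two linear maps and by a family of
functionals exists when there are fewer conditions than dimensions. -/
lemma exists_ne_zero_of_card_add_card_add_card_lt {ι : Type*} [Fintype ι] {m m' : ℕ}
    (Φ : (ι → ℝ) →ₗ[ℝ] (Fin m → ℝ)) (Ψ : (ι → ℝ) →ₗ[ℝ] (Fin m' → ℝ))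
    (l : ι → (ι → ℝ) →ₗ[ℝ] ℝ) (A : Finset (Fin m)) (B : Finset (Fin m')) (K : Finset ι)
    (h : A.card + B.card + K.card < Fintype.card ι) :
    ∃ x ≠ 0, (∀ a ∈ A, Φ x a = 0) ∧ (∀ a ∈ B, Ψ x a = 0) ∧ ∀ v ∈ K, l v x = 0 := by
  obtain ⟨x, hx, hl⟩ := exists_ne_zero_of_card_lt (κ := (A ⊕ B) ⊕ K)
    (Sum.elim (Sum.elim (fun a => LinearMap.proj a.1 ∘ₗ Φ) (fun a => LinearMap.proj a.1 ∘ₗ Ψ))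
      (fun v => l v.1)) (by simpa using h)
  exact ⟨x, hx, fun a ha => hl (.inl (.inl ⟨a, ha⟩)), fun a ha => hl (.inl (.inr ⟨a, ha⟩)),
    fun v hv => hl (.inr ⟨v, hv⟩)⟩

/-- Signs alternating along the edges of every bipartite component. -/
lemma exists_alternating_signs {V : Type*} (G : SimpleGraph V) :
    ∃ τ : V → ℝ, (∀ v, τ v ≠ 0) ∧ ∀ u v, G.Adj u v →
      (G.induce {w | G.connectedComponentMk w = G.connectedComponentMk v}).Colorable 2 →
      τ u = -τ v := by
  have hex (D : G.ConnectedComponent) : ∃ t : V → ℝ, (∀ v, t v ≠ 0) ∧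
      ((G.induce {w | G.connectedComponentMk w = D}).Colorable 2 → ∀ u v,
        G.connectedComponentMk u = D → G.connectedComponentMk v = D → G.Adj u v →
        t u = -t v) := by
    by_cases hD : (G.induce {w | G.connectedComponentMk w = D}).Colorable 2
    · obtain ⟨col⟩ := hD
      refine ⟨fun v => if h : G.connectedComponentMk v = D then
        (if col ⟨v, h⟩ = 0 then 1 else -1) else 1, fun v => ?_, fun _ u v hu hv huv => ?_⟩
      · beta_reduce
        split_ifs <;> norm_num
      · have hne : col ⟨u, hu⟩ ≠ col ⟨v, hv⟩ := col.valid huv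
        simp only [hu, hv, dif_pos]
        split_ifs with h1 h2 h2
        · exact absurd (h1.trans h2.symm) hne
        · norm_num
        · rfl
        · omega
    · exact ⟨1, fun _ => one_ne_zero, fun h => absurd h hD⟩
  choose t ht0 ht using hex
  refine ⟨fun v => t (G.connectedComponentMk v) v, fun v => ht0 _ v, fun u v huv hc => ?_⟩
  have hcomp : G.connectedComponentMk u = G.connectedComponentMk v :=
    SimpleGraph.ConnectedComponent.connectedComponentMk_eq_of_adj huv
  simp only [hcomp]
  exact ht _ hc u v hcomp rfl huv

/-- A diagonal form on vectors supported on the coordinates up to `i` is at most its `i`-th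
value. -/
lemma sum_mul_sq_le_of_monotone {m : ℕ} {lam : Fin m → ℝ} (hmono : Monotone lam) (i : Fin m)
    {y : Fin m → ℝ} (hy : ∀ a ∈ Finset.Ioi i, y a = 0) :
    ∑ a, lam a * y a ^ 2 ≤ lam i * ∑ a, y a ^ 2 := by
  rw [Finset.mul_sum]
  refine Finset.sum_le_sum fun a _ => ?_
  rcases le_or_gt a i with h | h
  · exact mul_le_mul_of_nonneg_right (hmono h) (sq_nonneg _)
  · simp [hy a (Finset.mem_Ioi.2 h)]

/-- A diagonal form on vectors supported on the coordinates from `i` on is at least its `i`-th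
value. -/
lemma le_sum_mul_sq_of_monotone {m : ℕ} {lam : Fin m → ℝ} (hmono : Monotone lam) (i : Fin m)
    {y : Fin m → ℝ} (hy : ∀ a ∈ Finset.Iio i, y a = 0) :
    lam i * ∑ a, y a ^ 2 ≤ ∑ a, lam a * y a ^ 2 := by
  rw [Finset.mul_sum]
  refine Finset.sum_le_sum fun a _ => ?_
  rcases lt_or_ge a i with h | h
  · simp [hy a (Finset.mem_Iio.2 h)]
  · exact mul_le_mul_of_nonneg_right (hmono h) (sq_nonneg _)

/-- A sum over the complement of `S` of a function vanishing on `S`. -/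
lemma sum_subtype_notMem_eq {V : Type*} [Fintype V] (S : Finset V) [Fintype {v // v ∉ S}]
    (f : V → ℝ) (hf : ∀ v ∈ S, f v = 0) : ∑ v : {v // v ∉ S}, f v = ∑ v, f v := by
  rw [← Finset.sum_subtype (Finset.univ.filter (· ∉ S)) (by simp) f]
  exact Finset.sum_filter_of_ne fun v _ hv hvS => hv (hf v hvS)

/-- **Subgraph deletion interlacing** for the normalised Laplacian:
`λ_{i-s+c+k} ≤ μᵢ` whenever `i-s+c+k ≥ 1`, and `μᵢ ≤ λ_{i+s-b}` whenever `i+s-b ≤ n`. -/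
theorem interlacing_normalised_subgraph_deletion
    {V : Type} [Fintype V] [DecidableEq V]
    (ε : V → V → ℝ) (hsym : ∀ u v, ε u v = ε v u)
    (hnonneg : ∀ u v, 0 ≤ ε u v) (hdiag : ∀ v, ε v v = 0)
    (hdeg : ∀ v, 0 < ∑ u, ε v u)
    (n : ℕ) (hn : n = Fintype.card V)
    (εe : Sym2 V → ℝ) (hεe : εe = Sym2.lift ⟨ε, fun a b => hsym a b⟩)
    (R : Finset (Sym2 V)) (hR : ∀ e ∈ R, ¬ e.IsDiag ∧ 0 < εe e)
    (VR : Finset V) (hVR : VR = Finset.univ.filter (fun v => ∃ e ∈ R, v ∈ e))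
    (s : ℕ) (hs : s = VR.card)
    (c : ℕ)
    (hc : c = (VR.image
      (SimpleGraph.fromEdgeSet (↑R : Set (Sym2 V))).connectedComponentMk).card)
    (b : ℕ)
    (hb : b = ((VR.image
        (SimpleGraph.fromEdgeSet (↑R : Set (Sym2 V))).connectedComponentMk).filter
      (fun C => ((SimpleGraph.fromEdgeSet (↑R : Set (Sym2 V))).induce
        {v : V | (SimpleGraph.fromEdgeSet (↑R : Set (Sym2 V))).connectedComponentMk v
          = C}).Colorable 2)).card)
    (εdel : V → V → ℝ)
    (hdel : εdel = fun u v => if s(u, v) ∈ R then 0 else ε u v)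
    (S : Finset V) (hSdef : S = Finset.univ.filter (fun v => ∑ u, εdel v u = 0))
    (k : ℕ) (hk : k = S.card)
    (lam : Fin n → ℝ) (hlamMono : Monotone lam)
    (hlam : (wlap ε (fun v => ∑ u, ε v u)).charpoly = ∏ i, (X - C (lam i)))
    (mu : Fin (n - k) → ℝ) (hmuMono : Monotone mu)
    (hmu : (wlap (fun x y : {v // v ∉ S} => εdel x.1 y.1)
        (fun x => ∑ y : {v // v ∉ S}, εdel x.1 y.1)).charpoly
        = ∏ i, (X - C (mu i))) :
    (∀ (i : Fin (n - k)) (j : Fin n),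
        (j : ℕ) + 1 + s = (i : ℕ) + 1 + c + k → lam j ≤ mu i) ∧
    (∀ (i : Fin (n - k)) (j : Fin n),
        (j : ℕ) + 1 + b = (i : ℕ) + 1 + s → mu i ≤ lam j) := by
  set G := SimpleGraph.fromEdgeSet (↑R : Set (Sym2 V))
  have hadj {u v : V} (h : s(u, v) ∈ R) : G.Adj u v := by
    refine (SimpleGraph.fromEdgeSet_adj _).2 ⟨h, fun huv => (hR _ h).1 ?_⟩
    simpa using huv
  have hcomp {u v : V} (h : s(u, v) ∈ R) : G.connectedComponentMk u = G.connectedComponentMk v :=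
    SimpleGraph.ConnectedComponent.connectedComponentMk_eq_of_adj (hadj h)
  have hmemVR {u v : V} (h : s(u, v) ∈ R) : u ∈ VR ∧ v ∈ VR := by
    rw [hVR]
    simp only [Finset.mem_filter_univ]
    exact ⟨⟨_, h, Sym2.mem_mk_left u v⟩, ⟨_, h, Sym2.mem_mk_right u v⟩⟩
  have hdelR {u v : V} (h : s(u, v) ∈ R) : εdel u v = 0 := by simp [hdel, h]
  have hdelR' {u v : V} (h : s(u, v) ∉ R) : εdel u v = ε u v := by simp [hdel, h]
  have hdelsym (u v) : εdel u v = εdel v u := by simp only [hdel, Sym2.eq_swap, hsym u v]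
  have hdelle (u v) : εdel u v ≤ ε u v := by
    by_cases h : s(u, v) ∈ R
    · rw [hdelR h]; exact hnonneg u v
    · rw [hdelR' h]
  have hdelnn (u v) : 0 ≤ εdel u v := by
    by_cases h : s(u, v) ∈ R
    · rw [hdelR h]
    · rw [hdelR' h]; exact hnonneg u v
  have hmemS {v : V} (hv : ∑ u, εdel v u = 0) : v ∈ S := by
    rw [hSdef, Finset.mem_filter_univ]
    exact hv
  have hS {v : V} (hv : v ∈ S) (u : V) : εdel v u = 0 := by
    rw [hSdef, Finset.mem_filter_univ] at hv
    exact (Finset.sum_eq_zero_iff_of_nonneg fun u _ => hdelnn v u).1 hv u (Finset.mem_univ u)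
  have hS' {v : V} (hv : v ∈ S) (u : V) : εdel u v = 0 := by rw [hdelsym, hS hv]
  have hdegS (v : V) : ∑ y : {v // v ∉ S}, εdel v y.1 = ∑ u, εdel v u :=
    sum_subtype_notMem_eq S (εdel v) fun u hu => hS' hu v
  have hdegpos (v : {v // v ∉ S}) : 0 < ∑ y : {v // v ∉ S}, εdel v.1 y.1 := by
    rw [hdegS]
    refine lt_of_le_of_ne (Finset.sum_nonneg fun u _ => hdelnn _ u) fun h =>
      v.2 (hmemS h.symm)
  obtain ⟨Φ, hΦ⟩ := exists_linearEquiv_diagonalizing ε hsym _ hdeg lam hlam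
  obtain ⟨Ψ, hΨ⟩ := exists_linearEquiv_diagonalizing (fun x y : {v // v ∉ S} => εdel x.1 y.1)
    (fun u v => hdelsym u v) _ hdegpos mu hmu
  have hmuIcc := normalised_eigenvalue_mem_Icc (fun x y : {v // v ∉ S} => εdel x.1 y.1)
    (fun u v => hdelsym u v) (fun u v => hdelnn u v) mu Ψ hΨ
  set res : (V → ℝ) →ₗ[ℝ] ({v // v ∉ S} → ℝ) := LinearMap.funLeft ℝ ℝ Subtype.val
  have hmass (x : V → ℝ) : ∑ a, Ψ (res x) a ^ 2 = ∑ v, (∑ u, εdel v u) * x v ^ 2 := by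
    rw [← (hΨ (res x)).1, ← sum_subtype_notMem_eq S]
    · exact Finset.sum_congr rfl fun v _ => by rw [hdegS]; rfl
    · intro v hv
      simp [hS hv]
  have hdouble (F : V → V → ℝ) : ∑ u : {v // v ∉ S}, ∑ v : {v // v ∉ S}, εdel u.1 v.1 * F u.1 v.1 =
      ∑ u, ∑ v, εdel u v * F u v := by
    rw [← sum_subtype_notMem_eq S]
    · exact Finset.sum_congr rfl fun u _ => sum_subtype_notMem_eq S (fun v => εdel u v * F u v)
        fun v hv => by rw [hS' hv, zero_mul]
    · exact fun u hu => Finset.sum_eq_zero fun v _ => by rw [hS hu, zero_mul]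
  have hmassle (x : V → ℝ) : ∑ v, (∑ u, εdel v u) * x v ^ 2 ≤ ∑ v, (∑ u, ε v u) * x v ^ 2 :=
    Finset.sum_le_sum fun v _ => mul_le_mul_of_nonneg_right
      (Finset.sum_le_sum fun u _ => hdelle v u) (sq_nonneg _)
  have hmassnn (x : V → ℝ) : 0 ≤ ∑ v, (∑ u, εdel v u) * x v ^ 2 :=
    Finset.sum_nonneg fun v _ => mul_nonneg (Finset.sum_nonneg fun u _ => hdelnn v u) (sq_nonneg _)
  have hmasspos (x : V → ℝ) (hx : x ≠ 0) : 0 < ∑ v, (∑ u, ε v u) * x v ^ 2 := by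
    obtain ⟨v, hv⟩ := Function.ne_iff.1 hx
    exact Finset.sum_pos' (fun v _ => mul_nonneg (hdeg v).le (sq_nonneg _))
      ⟨v, Finset.mem_univ v, mul_pos (hdeg v) (by simpa using sq_pos_of_ne_zero hv)⟩
  have hcongr (F : V → V → ℝ) (hF : ∀ u v, s(u, v) ∈ R → F u v = 0) :
      ∑ u, ∑ v, εdel u v * F u v = ∑ u, ∑ v, ε u v * F u v := by
    refine Finset.sum_congr rfl fun u _ => Finset.sum_congr rfl fun v _ => ?_
    by_cases h : s(u, v) ∈ R
    · rw [hF u v h, mul_zero, mul_zero]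
    · rw [hdelR' h]
  constructor
  · intro i j hij
    obtain ⟨K, l, hK, hl⟩ := exists_functionals_of_fibres VR G.connectedComponentMk
      (fun _ => True) 1 fun _ _ => one_ne_zero
    rw [Finset.filter_true, ← hs] at hK
    obtain ⟨x, hx, hxΦ, hxΨ, hxl⟩ := exists_ne_zero_of_card_add_card_add_card_lt Φ.toLinearMap
      (Ψ.toLinearMap ∘ₗ res) l (Finset.Iio j) (Finset.Ioi i) K (by
        rw [Fin.card_Iio, Fin.card_Ioi]
        have hK' : K.card + c = s := by rw [hc, ← hK]
        omega)
    obtain ⟨z, hz⟩ := hl x hxl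
    have hedge (u v : V) (h : s(u, v) ∈ R) : x u = x v := by
      simp [hz u (hmemVR h).1, hz v (hmemVR h).2, hcomp h]
    have h1 := le_sum_mul_sq_of_monotone hlamMono j hxΦ
    have h2 := sum_mul_sq_le_of_monotone hmuMono i hxΨ
    simp only [LinearEquiv.coe_coe, LinearMap.comp_apply] at h1 h2
    rw [← (hΦ x).1, ← (hΦ x).2, (dotProduct_lapMat_mulVec ε hsym x).1] at h1
    rw [hmass, ← (hΨ (res x)).2, (dotProduct_lapMat_mulVec
      (fun x y : {v // v ∉ S} => εdel x.1 y.1) (fun u v => hdelsym u v) _).1] at h2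
    have h3 := hdouble fun u v => (x u - x v) ^ 2
    rw [hcongr _ fun u v h => by rw [hedge u v h, sub_self, zero_pow two_ne_zero]] at h3
    have h4 := h2.trans (mul_le_mul_of_nonneg_left (hmassle x) (hmuIcc i).1)
    refine le_of_mul_le_mul_right (h1.trans (le_trans (le_of_eq ?_) h4)) (hmasspos x hx)
    rw [← h3]
    rfl
  · intro i j hij
    obtain ⟨τ, hτ0, hτ⟩ := exists_alternating_signs G
    obtain ⟨K, l, hK, hl⟩ := exists_functionals_of_fibres VR G.connectedComponentMk
      (fun D => (G.induce {v | G.connectedComponentMk v = D}).Colorable 2) τ fun v _ => hτ0 v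
    rw [← hs] at hK
    obtain ⟨x, hx, hxΦ, hxΨ, hxl⟩ := exists_ne_zero_of_card_add_card_add_card_lt Φ.toLinearMap
      (Ψ.toLinearMap ∘ₗ res) l (Finset.Ioi j) (Finset.Iio i) K (by
        rw [Fin.card_Iio, Fin.card_Ioi]
        have hK' : K.card + b = s := by rw [hb, ← hK]
        omega)
    obtain ⟨z, hz⟩ := hl x hxl
    have hedge (u v : V) (h : s(u, v) ∈ R) : x u + x v = 0 := by
      rw [hz u (hmemVR h).1, hz v (hmemVR h).2, hcomp h]
      split_ifs with hcol
      · rw [hτ u v (hadj h) hcol]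
        ring
      · exact add_zero 0
    have h1 := sum_mul_sq_le_of_monotone hlamMono j hxΦ
    have h2 := le_sum_mul_sq_of_monotone hmuMono i hxΨ
    simp only [LinearEquiv.coe_coe, LinearMap.comp_apply] at h1 h2
    rw [← (hΦ x).1, ← (hΦ x).2, (dotProduct_lapMat_mulVec ε hsym x).2] at h1
    rw [← (hΨ (res x)).2, (dotProduct_lapMat_mulVec
      (fun x y : {v // v ∉ S} => εdel x.1 y.1) (fun u v => hdelsym u v) _).2,
      (hΨ (res x)).1, hmass] at h2
    have h3 := hdouble fun u v => (x u + x v) ^ 2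
    rw [hcongr _ fun u v h => by rw [hedge u v h, zero_pow two_ne_zero]] at h3
    change _ ≤ 2 * _ - (∑ u : {v // v ∉ S}, ∑ v : {v // v ∉ S},
      εdel u.1 v.1 * (x u.1 + x v.1) ^ 2) / 2 at h2
    rw [h3] at h2
    by_contra! hlt
    nlinarith [(hmuIcc i).2, hmasspos x hx, hmassle x, hmassnn x,
      mul_nonneg (sub_nonneg.2 hlt.le) (hmassnn x),
      mul_nonneg (sub_nonneg.2 (hlt.le.trans (hmuIcc i).2)) (sub_nonneg.2 (hmassle x)),
      mul_pos (sub_pos.2 (hlt.trans_le (hmuIcc i).2)) (hmasspos x hx)]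
end

section
/- Let ε be an edge-weight function and υ a vertex-weight function on a finite set V with n = |V|, and let S ⊊ V with |S| = k be such that every connected component of G(ε) contains a vertex of V ∖ S. Write the combinatorial Laplacian L(ε) in block form with rows and columns indexed by V ∖ S first and then S: L(ε) = [[L₀, B],[C, D]], where D is the S × S principal submatrix. Then D is invertible; moreover, the Schur complement L₀ − B·D^{-1}·C is symmetric, and if μ_1 ≤ … ≤ μ_{n−k} denote the eigenvalues (with multiplicity, nondecreasing) of W(υ|_{V∖S})^{-1/2} (L₀ − B·D^{-1}·C) W(υ|_{V∖S})^{-1/2}, and λ_1 ≤ … ≤ λ_n the weighted Laplacian eigenvalues of (ε,υ), then λ_i ≤ μ_i ≤ λ_{i+k} for all 1 ≤ i ≤ n−k. -/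
open Matrix Polynomial
open scoped Classical

/-- Two families with the same multiset of values differ by a reindexing. -/
lemma exists_equiv_of_map_univ_eq {α β γ : Type*} [Fintype α] [Fintype β] (f : α → γ) (g : β → γ)
    (h : Multiset.map f Finset.univ.val = Multiset.map g Finset.univ.val) :
    ∃ σ : α ≃ β, ∀ a, g (σ a) = f a := by
  have hcard (c : γ) : Fintype.card {a // f a = c} = Fintype.card {b // g b = c} := by
    have := congrArg (Multiset.count c) h
    rw [Multiset.count_map, Multiset.count_map] at this
    rw [Fintype.card_subtype, Fintype.card_subtype]
    simpa [Finset.card_def, Finset.filter_val, eq_comm] using this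
  exact ⟨Equiv.ofFiberEquiv fun c => Fintype.equivOfCardEq (hcard c),
    fun a => Equiv.ofFiberEquiv_map _ a⟩

/-- Simultaneous diagonalization of a symmetric form `A` and a positive diagonal form `w`. -/
lemma exists_diagonalizing_map {ι : Type*} [Fintype ι] [DecidableEq ι] (A : Matrix ι ι ℝ)
    (hA : A.IsSymm) (w : ι → ℝ) (hw : ∀ i, 0 < w i) {n : ℕ} (lam : Fin n → ℝ)
    (hlam : (diagonal (fun i => (w i)⁻¹) * A).charpoly = ∏ i, (X - C (lam i))) :
    ∃ e : (ι → ℝ) →ₗ[ℝ] (Fin n → ℝ), Function.Surjective e ∧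
      (∀ x, x ⬝ᵥ A *ᵥ x = ∑ j, lam j * e x j ^ 2) ∧
      ∀ x, ∑ i, w i * x i ^ 2 = ∑ j, e x j ^ 2 := by
  set s : ι → ℝ := fun i => (√(w i))⁻¹
  set t : ι → ℝ := fun i => √(w i)
  have ht (i) : t i ≠ 0 := (Real.sqrt_pos.2 (hw i)).ne'
  have hts (i) : t i * s i = 1 := mul_inv_cancel₀ (ht i)
  set M := diagonal s * A * diagonal s with hM
  have hMH : M.IsHermitian := by
    rw [IsHermitian, conjTranspose_eq_transpose_of_trivial, hM]
    simp [transpose_mul, hA.eq, Matrix.mul_assoc]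
  have hchar : M.charpoly = ∏ i, (X - C (lam i)) := by
    rw [← hlam, hM, charpoly_mul_comm, ← Matrix.mul_assoc, diagonal_mul_diagonal]
    congr 3
    ext i
    rw [← mul_inv, Real.mul_self_sqrt (hw i).le]
  obtain ⟨σ, hσ⟩ := exists_equiv_of_map_univ_eq lam hMH.eigenvalues (by
    have h1 := hMH.roots_charpoly_eq_eigenvalues
    rw [hchar, Finset.prod_eq_multiset_prod,
      ← Function.comp_def (fun a => X - C a) lam, ← Multiset.map_map,
      roots_multiset_prod_X_sub_C] at h1
    exact h1)
  set U : Matrix ι ι ℝ := hMH.eigenvectorUnitary.1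
  have hUU : U * Uᵀ = 1 := by
    have := Unitary.coe_mul_star_self hMH.eigenvectorUnitary
    rwa [Unitary.coe_star, star_eq_conjTranspose, conjTranspose_eq_transpose_of_trivial] at this
  have hspec : M = U * diagonal hMH.eigenvalues * Uᵀ := by
    have := hMH.spectral_theorem
    rw [Unitary.conjStarAlgAut_apply, star_eq_conjTranspose,
      conjTranspose_eq_transpose_of_trivial] at this
    exact this
  have hA' : A = diagonal t * M * diagonal t := by
    have h1 : diagonal t * diagonal s = (1 : Matrix ι ι ℝ) := by
      simp [diagonal_mul_diagonal, hts]
    have h2 : diagonal s * diagonal t = (1 : Matrix ι ι ℝ) := by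
      simp [diagonal_mul_diagonal, mul_comm (s _), hts]
    calc A = (diagonal t * diagonal s) * A * (diagonal s * diagonal t) := by simp [h1, h2]
      _ = _ := by simp only [hM, Matrix.mul_assoc]
  set Q : Matrix ι ι ℝ := Uᵀ * diagonal t with hQ
  have hQT : Qᵀ = diagonal t * U := by simp [hQ, transpose_mul]
  have hform (d : ι → ℝ) (x : ι → ℝ) :
      x ⬝ᵥ (Qᵀ * diagonal d * Q) *ᵥ x = ∑ i, d i * (Q *ᵥ x) i ^ 2 := by
    rw [← mulVec_mulVec, ← mulVec_mulVec, dotProduct_mulVec, vecMul_transpose]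
    simp only [dotProduct, mulVec_diagonal]
    exact Finset.sum_congr rfl fun i _ => by ring
  have hnorm (x : ι → ℝ) : ∑ i, w i * x i ^ 2 = ∑ i, (Q *ᵥ x) i ^ 2 := by
    have h := hform 1 x
    have hw' : Qᵀ * diagonal (1 : ι → ℝ) * Q = diagonal w := by
      rw [hQT, hQ, Pi.one_def, diagonal_one, Matrix.mul_one, Matrix.mul_assoc,
        ← Matrix.mul_assoc U, hUU, Matrix.one_mul, diagonal_mul_diagonal]
      congr 1
      ext i
      exact Real.mul_self_sqrt (hw i).le
    rw [hw'] at h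
    simp only [Pi.one_apply, one_mul] at h
    rw [← h]
    simp only [dotProduct, mulVec_diagonal]
    exact Finset.sum_congr rfl fun i _ => by ring
  have hsurj : Function.Surjective (toLin' Q) := by
    have hunit : Q * (diagonal s * U) = 1 := by
      rw [hQ, Matrix.mul_assoc, ← Matrix.mul_assoc (diagonal t), diagonal_mul_diagonal]
      simp [hts, mul_eq_one_comm.mp hUU]
    intro y
    exact ⟨(diagonal s * U) *ᵥ y, by simp [hunit]⟩
  refine ⟨(LinearMap.funLeft ℝ ℝ σ) ∘ₗ toLin' Q, ?_, fun x => ?_, fun x => ?_⟩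
  · exact (LinearMap.funLeft_surjective_of_injective ℝ ℝ σ σ.injective).comp hsurj
  · have : A = Qᵀ * diagonal hMH.eigenvalues * Q := by
      rw [hQT, hQ]
      calc A = diagonal t * (U * diagonal hMH.eigenvalues * Uᵀ) * diagonal t := by
            rw [← hspec, ← hA']
        _ = _ := by simp only [Matrix.mul_assoc]
    conv_lhs => rw [this]
    rw [hform, ← σ.sum_comp]
    simp [hσ, LinearMap.funLeft_apply]
  · rw [hnorm, ← σ.sum_comp]
    simp [LinearMap.funLeft_apply]

/-- Eigenvalue comparison for two diagonalized quadratic forms, by dimension counting. -/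
lemma le_of_diagonal_forms {E : Type*} [AddCommGroup E] [Module ℝ E] [FiniteDimensional ℝ E]
    {p q : ℕ} (e : E →ₗ[ℝ] (Fin p → ℝ)) (f : E →ₗ[ℝ] (Fin q → ℝ))
    {a : Fin p → ℝ} {b : Fin q → ℝ} (ha : Monotone a) (hb : Monotone b)
    (hab : ∀ y, ∑ i, a i * e y i ^ 2 ≤ ∑ j, b j * f y j ^ 2)
    (hnorm : ∀ y, ∑ j, f y j ^ 2 ≤ ∑ i, e y i ^ 2)
    (hpos : ∀ y, y ≠ 0 → 0 < ∑ i, e y i ^ 2)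
    (i : Fin p) (j : Fin q) (hbj : 0 ≤ b j)
    (hdim : (i : ℕ) + (q - 1 - j) < Module.finrank ℝ E) : a i ≤ b j := by
  set F : E →ₗ[ℝ] ((Finset.Iio i → ℝ) × (Finset.Ioi j → ℝ)) :=
    ((LinearMap.funLeft ℝ ℝ Subtype.val) ∘ₗ e).prod ((LinearMap.funLeft ℝ ℝ Subtype.val) ∘ₗ f)
  have hF : LinearMap.ker F ≠ ⊥ := F.ker_ne_bot_of_finrank_lt (by
    rwa [Module.finrank_prod, Module.finrank_fintype_fun_eq_card,
      Module.finrank_fintype_fun_eq_card, Fintype.card_coe, Fintype.card_coe, Fin.card_Iio,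
      Fin.card_Ioi])
  obtain ⟨y, hy, hy0⟩ := (Submodule.ne_bot_iff _).mp hF
  obtain ⟨h1, h2⟩ := Prod.ext_iff.1 (LinearMap.mem_ker.1 hy)
  have he (l : Fin p) (hl : l < i) : e y l = 0 := congrFun h1 ⟨l, Finset.mem_Iio.2 hl⟩
  have hf (l : Fin q) (hl : j < l) : f y l = 0 := congrFun h2 ⟨l, Finset.mem_Ioi.2 hl⟩
  refine le_of_mul_le_mul_right ?_ (hpos y hy0)
  calc a i * ∑ l, e y l ^ 2 ≤ ∑ l, a l * e y l ^ 2 := by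
        rw [Finset.mul_sum]
        refine Finset.sum_le_sum fun l _ => ?_
        rcases lt_or_ge l i with hl | hl
        · simp [he l hl]
        · exact mul_le_mul_of_nonneg_right (ha hl) (sq_nonneg _)
    _ ≤ ∑ l, b l * f y l ^ 2 := hab y
    _ ≤ b j * ∑ l, f y l ^ 2 := by
        rw [Finset.mul_sum]
        refine Finset.sum_le_sum fun l _ => ?_
        rcases lt_or_ge j l with hl | hl
        · simp [hf l hl]
        · exact mul_le_mul_of_nonneg_right (hb hl) (sq_nonneg _)
    _ ≤ b j * ∑ l, e y l ^ 2 := mul_le_mul_of_nonneg_left (hnorm y) hbj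

lemma nonneg_of_diagonal_form {E : Type*} [AddCommGroup E] [Module ℝ E]
    {n : ℕ} (e : E →ₗ[ℝ] (Fin n → ℝ)) (he : Function.Surjective e) {a : Fin n → ℝ}
    (h : ∀ y, 0 ≤ ∑ i, a i * e y i ^ 2) (i : Fin n) : 0 ≤ a i := by
  obtain ⟨y, hy⟩ := he (Pi.single i 1)
  simpa [hy, Pi.single_apply] using h y

lemma lapMat_isSymm {V : Type} [Fintype V] [DecidableEq V] {ε : V → V → ℝ}
    (hsym : ∀ u v, ε u v = ε v u) : (lapMat ε).IsSymm := by
  rw [lapMat, IsSymm, transpose_sub, diagonal_transpose]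
  congr 1
  ext u v
  exact hsym v u

lemma two_mul_dotProduct_lapMat {V : Type} [Fintype V] [DecidableEq V] {ε : V → V → ℝ}
    (hsym : ∀ u v, ε u v = ε v u) (x : V → ℝ) :
    2 * (x ⬝ᵥ lapMat ε *ᵥ x) = ∑ u, ∑ v, ε u v * (x u - x v) ^ 2 := by
  have h1 : x ⬝ᵥ lapMat ε *ᵥ x = ∑ u, ∑ v, ε u v * (x u ^ 2 - x u * x v) := by
    simp only [lapMat, sub_mulVec, dotProduct, Pi.sub_apply, mulVec_diagonal]
    refine Finset.sum_congr rfl fun u _ => ?_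
    simp only [mulVec, dotProduct, of_apply, mul_sub, Finset.mul_sum, Finset.sum_mul,
      ← Finset.sum_sub_distrib]
    exact Finset.sum_congr rfl fun v _ => by ring
  have h2 : x ⬝ᵥ lapMat ε *ᵥ x = ∑ u, ∑ v, ε u v * (x v ^ 2 - x u * x v) := by
    rw [h1, Finset.sum_comm]
    exact Finset.sum_congr rfl fun u _ => Finset.sum_congr rfl fun v _ => by
      rw [hsym]; ring
  rw [two_mul]
  nth_rewrite 1 [h1]
  rw [h2, ← Finset.sum_add_distrib]
  refine Finset.sum_congr rfl fun u _ => ?_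
  rw [← Finset.sum_add_distrib]
  exact Finset.sum_congr rfl fun v _ => by ring

lemma dotProduct_lapMat_nonneg {V : Type} [Fintype V] [DecidableEq V] {ε : V → V → ℝ}
    (hsym : ∀ u v, ε u v = ε v u) (hnonneg : ∀ u v, 0 ≤ ε u v) (x : V → ℝ) :
    0 ≤ x ⬝ᵥ lapMat ε *ᵥ x := by
  have h := two_mul_dotProduct_lapMat hsym x
  have : 0 ≤ ∑ u, ∑ v, ε u v * (x u - x v) ^ 2 :=
    Finset.sum_nonneg fun u _ => Finset.sum_nonneg fun v _ =>
      mul_nonneg (hnonneg u v) (sq_nonneg _)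
  linarith

lemma eq_of_reachable_of_dotProduct_lapMat_eq_zero {V : Type} [Fintype V] [DecidableEq V]
    {ε : V → V → ℝ} (hsym : ∀ u v, ε u v = ε v u) (hnonneg : ∀ u v, 0 ≤ ε u v) {x : V → ℝ}
    (hx : x ⬝ᵥ lapMat ε *ᵥ x = 0) {u v : V}
    (huv : (SimpleGraph.fromRel (fun x y => 0 < ε x y)).Reachable u v) : x u = x v := by
  have h := two_mul_dotProduct_lapMat hsym x
  have hterm (u v) : 0 ≤ ε u v * (x u - x v) ^ 2 := mul_nonneg (hnonneg u v) (sq_nonneg _)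
  rw [hx, mul_zero, eq_comm, Finset.sum_eq_zero_iff_of_nonneg
    fun u _ => Finset.sum_nonneg fun v _ => hterm u v] at h
  have hadj (u v) (hε : 0 < ε u v) : x u = x v := by
    have := (Finset.sum_eq_zero_iff_of_nonneg fun v _ => hterm u v).1 (h u (Finset.mem_univ u)) v
      (Finset.mem_univ v)
    exact sub_eq_zero.1 (pow_eq_zero_iff two_ne_zero |>.1
      ((mul_eq_zero.1 this).resolve_left hε.ne'))
  obtain ⟨p⟩ := huv
  induction p with
  | nil => rfl
  | cons hadj' _ ih =>
    rw [← ih]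
    obtain ⟨-, h | h⟩ := (SimpleGraph.fromRel_adj _ _ _).1 hadj'
    · exact hadj _ _ h
    · exact (hadj _ _ h).symm

/-- **Kron reduction interlacing**: writing the Laplacian in block form
`[[L₀, B], [C, D]]` over `V ∖ S` and `S`, the block `D` is invertible, the Schur
complement `L₀ - B D⁻¹ C` is symmetric, and its weighted eigenvalues interlace:
`λᵢ ≤ μᵢ ≤ λ_{i+k}`. -/
theorem interlacing_kron_reduction
    {V : Type} [Fintype V] [DecidableEq V]
    (ε : V → V → ℝ) (hsym : ∀ u v, ε u v = ε v u)
    (hnonneg : ∀ u v, 0 ≤ ε u v) (hdiag : ∀ v, ε v v = 0)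
    (υ : V → ℝ) (hυ : ∀ v, 0 < υ v)
    (n : ℕ) (hn : n = Fintype.card V)
    (S : Finset V) (k : ℕ) (hk : k = S.card) (hSproper : S ≠ Finset.univ)
    (hcomp : ∀ v : V, ∃ u : V, u ∉ S ∧
      (SimpleGraph.fromRel (fun x y => 0 < ε x y)).Reachable v u)
    (L₀ : Matrix {v // v ∉ S} {v // v ∉ S} ℝ)
    (hL₀ : L₀ = Matrix.of fun x y => lapMat ε x.1 y.1)
    (Bm : Matrix {v // v ∉ S} {v // v ∈ S} ℝ)
    (hB : Bm = Matrix.of fun x y => lapMat ε x.1 y.1)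
    (Cm : Matrix {v // v ∈ S} {v // v ∉ S} ℝ)
    (hC : Cm = Matrix.of fun x y => lapMat ε x.1 y.1)
    (Dm : Matrix {v // v ∈ S} {v // v ∈ S} ℝ)
    (hD : Dm = Matrix.of fun x y => lapMat ε x.1 y.1)
    (lam : Fin n → ℝ) (hlamMono : Monotone lam)
    (hlam : (wlap ε υ).charpoly = ∏ i, (X - C (lam i)))
    (mu : Fin (n - k) → ℝ) (hmuMono : Monotone mu)
    (hmu : (Matrix.diagonal (fun x : {v // v ∉ S} => (Real.sqrt (υ x.1))⁻¹) *
        (L₀ - Bm * Dm⁻¹ * Cm) *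
        Matrix.diagonal (fun x : {v // v ∉ S} => (Real.sqrt (υ x.1))⁻¹)).charpoly
        = ∏ i, (X - C (mu i))) :
    IsUnit Dm.det ∧ (L₀ - Bm * Dm⁻¹ * Cm).IsSymm ∧
    ∀ i : Fin (n - k),
      lam ⟨(i : ℕ), by have := i.2; omega⟩ ≤ mu i ∧
      mu i ≤ lam ⟨(i : ℕ) + k, by have := i.2; omega⟩ := by
  subst hn hk
  have hcardκ : Fintype.card {v // v ∉ S} = Fintype.card V - S.card := by
    rw [Fintype.card_subtype_compl, Fintype.card_coe]
  have hLs := lapMat_isSymm hsym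
  have hLn := dotProduct_lapMat_nonneg hsym hnonneg
  -- the vector on `V` with parts `y` off `S` and `z` on `S`
  set G : ({v // v ∉ S} → ℝ) × ({v // v ∈ S} → ℝ) →ₗ[ℝ] (V → ℝ) :=
    { toFun := fun p v => if h : v ∈ S then p.2 ⟨v, h⟩ else p.1 ⟨v, h⟩
      map_add' := fun p q => by ext v; by_cases h : v ∈ S <;> simp [h]
      map_smul' := fun c p => by ext v; by_cases h : v ∈ S <;> simp [h] } with hG
  have hG0 (y z) (v : {v // v ∉ S}) : G (y, z) v = y v := by simp [hG, v.2]
  have hG1 (y z) (v : {v // v ∈ S}) : G (y, z) v = z v := by simp [hG, v.2]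
  have hsum (g : V → ℝ) : ∑ v, g v = ∑ v : {v // v ∉ S}, g v + ∑ v : {v // v ∈ S}, g v := by
    rw [add_comm]
    convert (Fintype.sum_subtype_add_sum_subtype (fun v => v ∈ S) g).symm
  have hquad (y z) : G (y, z) ⬝ᵥ lapMat ε *ᵥ G (y, z) =
      y ⬝ᵥ (L₀ *ᵥ y + Bm *ᵥ z) + z ⬝ᵥ (Cm *ᵥ y + Dm *ᵥ z) := by
    subst hL₀ hB hC hD
    simp only [dotProduct, mulVec, hsum, hG0, hG1, Pi.add_apply, of_apply]
  have hBT : Bmᵀ = Cm := by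
    subst hB hC
    ext u v
    exact hLs.apply _ _
  have hLT : L₀ᵀ = L₀ := by
    subst hL₀
    ext u v
    exact hLs.apply _ _
  have hDT : Dmᵀ = Dm := by
    subst hD
    ext u v
    exact hLs.apply _ _
  have hDu : IsUnit Dm.det := by
    rw [isUnit_iff_ne_zero]
    intro h0
    obtain ⟨z, hz, hDz⟩ := exists_mulVec_eq_zero_iff.2 h0
    apply hz
    have hq := hquad 0 z
    simp only [hDz, mulVec_zero, zero_dotProduct, add_zero, dotProduct_zero] at hq
    ext v
    obtain ⟨u, hu, hr⟩ := hcomp v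
    have := eq_of_reachable_of_dotProduct_lapMat_eq_zero hsym hnonneg hq hr
    rw [hG1] at this
    rw [this, hG0 0 z ⟨u, hu⟩]
    rfl
  have hNs : (L₀ - Bm * Dm⁻¹ * Cm).IsSymm := by
    rw [IsSymm, transpose_sub, transpose_mul, transpose_mul, transpose_nonsing_inv, hLT, hDT,
      ← hBT, transpose_transpose, Matrix.mul_assoc]
  refine ⟨hDu, hNs, ?_⟩
  set N := L₀ - Bm * Dm⁻¹ * Cm with hN
  -- extension by zero, and harmonic extension
  set Z := G ∘ₗ LinearMap.inl ℝ _ _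
  set H := G ∘ₗ (LinearMap.id.prod (toLin' (-(Dm⁻¹ * Cm))))
  have hH (y) : H y ⬝ᵥ lapMat ε *ᵥ H y = y ⬝ᵥ N *ᵥ y := by
    have h1 : Cm *ᵥ y + Dm *ᵥ (-(Dm⁻¹ * Cm) *ᵥ y) = 0 := by
      rw [mulVec_mulVec, Matrix.mul_neg, ← Matrix.mul_assoc, mul_nonsing_inv _ hDu,
        Matrix.one_mul, neg_mulVec, add_neg_cancel]
    refine (hquad y (-(Dm⁻¹ * Cm) *ᵥ y)).trans ?_
    rw [h1, dotProduct_zero, add_zero, mulVec_mulVec, ← add_mulVec, hN, Matrix.mul_neg,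
      ← sub_eq_add_neg, Matrix.mul_assoc]
  have hDn (z) : 0 ≤ z ⬝ᵥ Dm *ᵥ z := by
    simpa [hquad] using hLn (G (0, z))
  have hZ (y) : y ⬝ᵥ N *ᵥ y ≤ Z y ⬝ᵥ lapMat ε *ᵥ Z y := by
    have h1 : Z y ⬝ᵥ lapMat ε *ᵥ Z y = y ⬝ᵥ L₀ *ᵥ y := by
      refine (hquad y 0).trans ?_
      simp
    have h2 := hDn ((Dm⁻¹ * Cm) *ᵥ y)
    have h3 : Dm *ᵥ (Dm⁻¹ * Cm) *ᵥ y = Cm *ᵥ y := by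
      rw [mulVec_mulVec, ← Matrix.mul_assoc, mul_nonsing_inv _ hDu, Matrix.one_mul]
    have h4 (z) : Cm *ᵥ y ⬝ᵥ z = y ⬝ᵥ Bm *ᵥ z := by
      rw [← hBT, mulVec_transpose, ← dotProduct_mulVec]
    rw [h3, dotProduct_comm, h4, mulVec_mulVec, ← Matrix.mul_assoc] at h2
    rw [h1, hN, sub_mulVec, dotProduct_sub]
    linarith
  have hZnorm (y) : ∑ v, υ v * Z y v ^ 2 = ∑ v : {v // v ∉ S}, υ v * y v ^ 2 := by
    rw [hsum]
    simp [Z, hG0, hG1]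
  have hHnorm (y) : ∑ v : {v // v ∉ S}, υ v * y v ^ 2 ≤ ∑ v, υ v * H y v ^ 2 := by
    rw [hsum (fun v => υ v * H y v ^ 2)]
    simp only [H, LinearMap.comp_apply, LinearMap.prod_apply, Function.prod, LinearMap.id_apply, hG0]
    exact le_add_of_nonneg_right
      (Finset.sum_nonneg fun v _ => mul_nonneg (hυ v).le (sq_nonneg _))
  have hpos (y : {v // v ∉ S} → ℝ) (hy : y ≠ 0) : 0 < ∑ v : {v // v ∉ S}, υ v * y v ^ 2 := by
    obtain ⟨v, hv⟩ := Function.ne_iff.1 hy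
    exact Finset.sum_pos' (fun v _ => mul_nonneg (hυ v).le (sq_nonneg _))
      ⟨v, Finset.mem_univ v, mul_pos (hυ v) (sq_pos_of_ne_zero hv)⟩
  obtain ⟨e, hes, heq, hen⟩ := exists_diagonalizing_map _ hLs υ hυ lam hlam
  obtain ⟨f, hfs, hfq, hfn⟩ := exists_diagonalizing_map N hNs (fun v => υ v) (fun v => hυ v) mu (by
    rw [← hmu, charpoly_mul_comm (diagonal _ * N), ← Matrix.mul_assoc, diagonal_mul_diagonal]
    congr 3
    ext v
    rw [← mul_inv, Real.mul_self_sqrt (hυ v).le])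
  have hlam0 := nonneg_of_diagonal_form e hes fun x => heq x ▸ hLn x
  have hmu0 := nonneg_of_diagonal_form f hfs fun y => hfq y ▸ hH y ▸ hLn (H y)
  intro i
  have hi := i.2
  constructor
  · refine le_of_diagonal_forms (e ∘ₗ H) f hlamMono hmuMono (fun y => ?_) (fun y => ?_)
      (fun y hy => ?_) _ i (hmu0 i) ?_
    · rw [LinearMap.comp_apply, ← heq, ← hfq, hH]
    · rw [LinearMap.comp_apply, ← hen, ← hfn]
      exact hHnorm y
    · rw [LinearMap.comp_apply, ← hen]
      exact (hpos y hy).trans_le (hHnorm y)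
    · rw [Module.finrank_fintype_fun_eq_card, hcardκ]
      simp only
      omega
  · refine le_of_diagonal_forms f (e ∘ₗ Z) hmuMono hlamMono (fun y => ?_) (fun y => ?_)
      (fun y hy => ?_) i _ (hlam0 _) ?_
    · rw [LinearMap.comp_apply, ← heq, ← hfq]
      exact hZ y
    · rw [LinearMap.comp_apply, ← hen, ← hfn, hZnorm]
    · rw [← hfn]
      exact hpos y hy
    · rw [Module.finrank_fintype_fun_eq_card, hcardκ]
      simp only
      omega
end

section
/- Let ε be an edge-weight function on a finite set V with n = |V|, suppose there exist distinct u,v ∈ V with ε(u,v) > 0, and let λ_n be the largest eigenvalue of the combinatorial Laplacian L(ε). Let S ⊆ V be a nonempty independent set, i.e. ε(u,v) = 0 for all u,v ∈ S, and let d̄(S) = (∑_{v ∈ S} d_ε(v))/|S| be the average degree over S. Then λ_n > 0 and |S| ≤ n · (λ_n − d̄(S)) / λ_n. -/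
open Matrix Polynomial
open scoped Classical

/-- A real symmetric matrix whose characteristic roots are at most `c` satisfies
`xᵀ A x ≤ c xᵀ x`. -/
theorem dotProduct_mulVec_le_of_charpoly_roots_le {V : Type*} [Fintype V] [DecidableEq V]
    {A : Matrix V V ℝ} (hA : A.IsHermitian) {c : ℝ}
    (hc : ∀ r, A.charpoly.IsRoot r → r ≤ c) (x : V → ℝ) :
    x ⬝ᵥ (A *ᵥ x) ≤ c * (x ⬝ᵥ x) := by
  have hpsd : (algebraMap ℝ (Matrix V V ℝ) c - A).PosSemidef := by
    rw [posSemidef_iff_isHermitian_and_spectrum_nonneg]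
    refine ⟨?_, fun r hr => ?_⟩
    · rw [algebraMap_eq_diagonal]
      exact (isHermitian_diagonal _).sub hA
    · rw [← spectrum.singleton_sub_eq] at hr
      obtain ⟨_, rfl, s, hs, rfl⟩ := hr
      exact sub_nonneg.2 (hc s (mem_spectrum_iff_isRoot_charpoly.1 hs))
  have h := hpsd.dotProduct_mulVec_nonneg x
  simpa [Algebra.algebraMap_eq_smul_one, sub_mulVec, dotProduct_sub, smul_mulVec] using h

theorem lapMat_mulVec_apply {V : Type} [Fintype V] [DecidableEq V] (ε : V → V → ℝ)
    (x : V → ℝ) (v : V) :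
    (lapMat ε *ᵥ x) v = (∑ u, ε v u) * x v - ∑ u, ε v u * x u := by
  rw [lapMat, sub_mulVec, Pi.sub_apply, mulVec_diagonal]
  rfl

theorem lapMat_isHermitian {V : Type} [Fintype V] [DecidableEq V] {ε : V → V → ℝ}
    (hsym : ∀ u v, ε u v = ε v u) : (lapMat ε).IsHermitian := by
  refine (isHermitian_diagonal _).sub ?_
  ext u v
  simp [hsym u v]

theorem lapMat_mulVec_one {V : Type} [Fintype V] [DecidableEq V] (ε : V → V → ℝ) :
    lapMat ε *ᵥ 1 = 0 := by
  ext v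
  simp [lapMat_mulVec_apply]

theorem one_dotProduct_lapMat_mulVec {V : Type} [Fintype V] [DecidableEq V] {ε : V → V → ℝ}
    (hsym : ∀ u v, ε u v = ε v u) (x : V → ℝ) : 1 ⬝ᵥ (lapMat ε *ᵥ x) = 0 := by
  have h : (lapMat ε)ᵀ = lapMat ε := lapMat_isHermitian hsym
  rw [dotProduct_mulVec, ← mulVec_transpose, h, lapMat_mulVec_one, zero_dotProduct]

theorem indicator_dotProduct_lapMat_mulVec {V : Type} [Fintype V] [DecidableEq V]
    {ε : V → V → ℝ} {S : Finset V} (hind : ∀ u ∈ S, ∀ v ∈ S, ε u v = 0) :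
    (fun v => if v ∈ S then (1 : ℝ) else 0) ⬝ᵥ
      (lapMat ε *ᵥ fun v => if v ∈ S then (1 : ℝ) else 0) = ∑ v ∈ S, ∑ u, ε v u := by
  simp only [dotProduct, lapMat_mulVec_apply, ite_mul, one_mul, zero_mul, mul_ite, mul_one,
    mul_zero, Finset.sum_ite_mem, Finset.univ_inter]
  refine Finset.sum_congr rfl fun v hv => ?_
  rw [if_pos hv, Finset.sum_eq_zero (hind v hv), sub_zero]

/-- **Combinatorial Laplacian independent set bound**: for a nonempty independent set
`S`, `|S| ≤ n (λₙ - d̄(S))/λₙ`, where `d̄(S)` is the average degree over `S`. -/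
theorem combinatorial_independent_set_bound
    {V : Type} [Fintype V] [DecidableEq V]
    (ε : V → V → ℝ) (hsym : ∀ u v, ε u v = ε v u)
    (hnonneg : ∀ u v, 0 ≤ ε u v) (hdiag : ∀ v, ε v v = 0)
    (n : ℕ) (hn : n = Fintype.card V)
    (hedge : ∃ u v : V, u ≠ v ∧ 0 < ε u v)
    (lam : Fin n → ℝ) (hlamMono : Monotone lam)
    (hlam : (lapMat ε).charpoly = ∏ i, (X - C (lam i)))
    (S : Finset V) (hSne : S.Nonempty)
    (hind : ∀ u ∈ S, ∀ v ∈ S, ε u v = 0)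
    (dbarS : ℝ) (hdbarS : dbarS = (∑ v ∈ S, ∑ u, ε v u) / S.card) :
    ∀ i : Fin n, (i : ℕ) + 1 = n →
      0 < lam i ∧ (S.card : ℝ) ≤ n * (lam i - dbarS) / lam i := by
  intro i hi
  have hroot : ∀ r, (lapMat ε).charpoly.IsRoot r → r ≤ lam i := by
    intro r hr
    rw [hlam, IsRoot, eval_prod, Finset.prod_eq_zero_iff] at hr
    obtain ⟨j, -, hj⟩ := hr
    rw [eval_sub, eval_X, eval_C, sub_eq_zero] at hj
    exact hj ▸ hlamMono (Fin.le_def.2 (by omega))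
  have hray := dotProduct_mulVec_le_of_charpoly_roots_le (lapMat_isHermitian hsym) hroot
  have hpos : 0 < lam i := by
    obtain ⟨u, v, -, huv⟩ := hedge
    have hdeg : 0 < ∑ w, ε u w :=
      Finset.sum_pos' (fun w _ => hnonneg u w) ⟨v, Finset.mem_univ v, huv⟩
    have h := hray (Pi.single u 1)
    simp only [single_one_dotProduct, lapMat_mulVec_apply, Pi.single_eq_same, mul_one] at h
    simp only [Pi.single_apply, mul_ite, mul_one, mul_zero, Finset.sum_ite_eq',
      Finset.mem_univ, if_true, hdiag, sub_zero] at h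
    exact hdeg.trans_le h
  refine ⟨hpos, ?_⟩
  have hs : (0 : ℝ) < S.card := by exact_mod_cast hSne.card_pos
  have hsn : (S.card : ℝ) ≤ n := by
    rw [hn]
    exact_mod_cast S.card_le_univ
  have hn0 : (0 : ℝ) < n := hs.trans_le hsn
  set t : ℝ := S.card / n
  set f : V → ℝ := fun v => if v ∈ S then 1 else 0 with hf
  have hff : f ⬝ᵥ f = S.card := by simp [hf, dotProduct]
  have hf1 : f ⬝ᵥ 1 = S.card := by simp [hf, dotProduct]
  have h11 : (1 : V → ℝ) ⬝ᵥ 1 = n := by simp [hn]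
  have h := hray (f - t • 1)
  rw [mulVec_sub, mulVec_smul, lapMat_mulVec_one, smul_zero, sub_zero, sub_dotProduct,
    smul_dotProduct, one_dotProduct_lapMat_mulVec hsym, smul_zero, sub_zero,
    indicator_dotProduct_lapMat_mulVec hind] at h
  simp only [sub_dotProduct, dotProduct_sub, smul_dotProduct, dotProduct_smul, hff, hf1, h11,
    dotProduct_comm 1 f, smul_eq_mul] at h
  have hd : ∑ v ∈ S, ∑ u, ε v u = dbarS * S.card := by
    rw [hdbarS, div_mul_cancel₀ _ hs.ne']
  have htn : t * n = S.card := div_mul_cancel₀ _ hn0.ne'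
  have hbound : dbarS ≤ lam i * (1 - t) := by
    refine le_of_mul_le_mul_right ?_ hs
    rw [hd, htn] at h
    linarith
  rw [le_div_iff₀ hpos]
  nlinarith [mul_le_mul_of_nonneg_left hbound hn0.le]
end
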